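/- Let G = A ∗_C B be an amalgamated free product and let N be a nontrivial finitely generated normal subgroup of G with N ∩ C = {1}. Let a = [G : NA], b = [G : NB], and c = [G : NC] be the (finite) indices of the subgroups generated by N together with A, B, and C respectively. Then, as an equation of integers, rank(N) = a·rank(N ∩ A) + b·rank(N ∩ B) + 1 + c − a − b, where rank denotes the minimal number of generators of a group. -/

import Mathlib

open Monoid

/-- The rank of a group: the minimal cardinality of a (finite) generating set
(with junk value `0` via `sInf ∅` if the group is not finitely generated). -/
noncomputable def minRank (G : Type*) [Group G] : ℕ :=
  sInf {n : ℕ | ∃ S : Finset G, S.card = n ∧ Subgroup.closure (S : Set G) = ⊤}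

open MulAction

universe u v

/-- The `N`-set `X` has finitely many orbits, and one can choose orbit representatives `x i` and
finite generating sets `S i` of their stabilizers such that `∑ i, (|S i| - 1) ≤ k`. -/
def OrbitBound (N : Type u) [Group N] (X : Type v) [MulAction N X] (k : ℤ) : Prop :=
  ∃ (ι : Type u) (_ : Fintype ι) (x : ι → X) (S : ι → Finset N),
    (∀ y, ∃ i, ∃ n : N, n • x i = y) ∧ (∀ i j, ∀ n : N, n • x i = x j → i = j) ∧
    (∀ i, Subgroup.closure (S i : Set N) = stabilizer N (x i)) ∧
    ∑ i, (((S i).card : ℤ) - 1) ≤ k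

section Glue

variable {N : Type u} [Group N] {X : Type u} [MulAction N X]

variable (N) in
/-- The subgroup of elements that fix the common image of `u` and `w` once these two points are
identified equivariantly. -/
def glueStabilizer (u w : X) : Subgroup N :=
  Subgroup.closure {n | n • u = u ∨ n • w = w ∨ n • u = w}

theorem inv_mul_mem_glueStabilizer {u w y : X} {n m : N} (hn : y = n • u ∨ y = n • w)
    (hm : y = m • u ∨ y = m • w) : n⁻¹ * m ∈ glueStabilizer N u w := by
  have key : ∀ g : N, g • u = u ∨ g • w = w ∨ g • u = w → g ∈ glueStabilizer N u w :=
    fun g hg => Subgroup.subset_closure hg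
  rcases hn with hn | hn <;> rcases hm with hm | hm
  · exact key _ (Or.inl (by rw [mul_smul, ← hm, hn, inv_smul_smul]))
  · rw [← inv_mem_iff]
    exact key _ (Or.inr (Or.inr (by rw [mul_inv_rev, inv_inv, mul_smul, ← hn, hm, inv_smul_smul])))
  · exact key _ (Or.inr (Or.inr (by rw [mul_smul, ← hm, hn, inv_smul_smul])))
  · exact key _ (Or.inr (Or.inl (by rw [mul_smul, ← hm, hn, inv_smul_smul])))

variable (N) in
/-- The smallest `N`-invariant equivalence relation identifying `u` and `w`. -/
def glueSetoid (u w : X) : Setoid X where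
  r y z := y = z ∨ ∃ n m : N, (y = n • u ∨ y = n • w) ∧ (z = m • u ∨ z = m • w) ∧
    n⁻¹ * m ∈ glueStabilizer N u w
  iseqv :=
    { refl := fun _ => Or.inl rfl
      symm := by
        rintro y z (rfl | ⟨n, m, hn, hm, h⟩)
        · exact Or.inl rfl
        · exact Or.inr ⟨m, n, hm, hn, by simpa using inv_mem h⟩
      trans := by
        rintro y z t (rfl | ⟨n, m, hn, hm, h⟩) (rfl | ⟨n', m', hn', hm', h'⟩)
        · exact Or.inl rfl
        · exact Or.inr ⟨n', m', hn', hm', h'⟩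
        · exact Or.inr ⟨n, m, hn, hm, h⟩
        · refine Or.inr ⟨n, m', hn, hm', ?_⟩
          have := mul_mem (mul_mem h (inv_mul_mem_glueStabilizer hm hn')) h'
          simpa [mul_assoc] using this }

variable (N) in
/-- The quotient of `X` identifying `u` and `w` equivariantly. -/
def Glue (u w : X) : Type u := Quotient (glueSetoid N u w)

variable (N) in
/-- The projection to `Glue`. -/
def Glue.mk (u w : X) (y : X) : Glue N u w := Quotient.mk (glueSetoid N u w) y

theorem Glue.mk_surjective (u w : X) : Function.Surjective (Glue.mk N u w) :=
  Quotient.mk_surjective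

theorem Glue.mk_eq_mk {u w y z : X} : Glue.mk N u w y = Glue.mk N u w z ↔
    y = z ∨ ∃ n m : N, (y = n • u ∨ y = n • w) ∧ (z = m • u ∨ z = m • w) ∧
      n⁻¹ * m ∈ glueStabilizer N u w :=
  Quotient.eq (r := glueSetoid N u w)

instance (u w : X) : MulAction N (Glue N u w) where
  smul g := Quotient.map (g • ·) (by
    rintro y z (rfl | ⟨n, m, hn, hm, h⟩)
    · exact Or.inl rfl
    · refine Or.inr ⟨g * n, g * m, ?_, ?_, by simpa [mul_assoc] using h⟩
      · simpa [mul_smul] using hn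
      · simpa [mul_smul] using hm)
  one_smul := by
    rintro ⟨y⟩
    exact congrArg (Glue.mk N u w) (one_smul N y)
  mul_smul := by
    rintro g h ⟨y⟩
    exact congrArg (Glue.mk N u w) (mul_smul g h y)

theorem Glue.smul_mk (u w : X) (g : N) (y : X) : g • Glue.mk N u w y = Glue.mk N u w (g • y) := rfl

theorem Glue.mk_left_eq_mk_right (u w : X) : Glue.mk N u w u = Glue.mk N u w w :=
  Glue.mk_eq_mk.2 (Or.inr ⟨1, 1, by simp, by simp, by simp [one_mem]⟩)

theorem Glue.stabilizer_mk (u w : X) :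
    stabilizer N (Glue.mk N u w u) = glueStabilizer N u w := by
  apply le_antisymm
  · intro g hg
    rw [mem_stabilizer_iff, Glue.smul_mk, Glue.mk_eq_mk] at hg
    rcases hg with hg | ⟨n, m, hn, hm, h⟩
    · exact Subgroup.subset_closure (Or.inl hg)
    · have h1 := inv_mul_mem_glueStabilizer (Or.inl rfl) hn
      have h2 := inv_mul_mem_glueStabilizer (n := m) (m := (1 : N)) hm (by simp)
      rw [← inv_mem_iff]
      simpa [mul_assoc] using mul_mem (mul_mem h1 h) h2
  · refine (Subgroup.closure_le _).2 ?_
    have e := Glue.mk_left_eq_mk_right (N := N) u w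
    rintro g (hg | hg | hg) <;> rw [SetLike.mem_coe, mem_stabilizer_iff]
    · rw [Glue.smul_mk, hg]
    · rw [e, Glue.smul_mk, hg]
    · rw [Glue.smul_mk, hg, e]

/-- Away from the orbits of `u` and `w`, the projection to `Glue` is injective. -/
theorem Glue.eq_of_mk_eq_mk {u w y z : X} (hu : ∀ n : N, n • u ≠ y) (hw : ∀ n : N, n • w ≠ y)
    (h : Glue.mk N u w y = Glue.mk N u w z) : y = z := by
  rcases Glue.mk_eq_mk.1 h with h | ⟨n, m, hn | hn, -, -⟩
  · exact h
  · exact absurd hn.symm (hu n)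
  · exact absurd hn.symm (hw n)

/-- Equivariant maps identifying `u` and `w` factor through `Glue`. -/
theorem Glue.exists_lift {V : Type v} [MulAction N V] {u w : X} (f : X →[N] V) (h : f u = f w) :
    ∃ f' : Glue N u w →[N] V, ∀ x, f' (Glue.mk N u w x) = f x := by
  have hH : glueStabilizer N u w ≤ stabilizer N (f u) := by
    refine (Subgroup.closure_le _).2 ?_
    rintro g (hg | hg | hg) <;> rw [SetLike.mem_coe, mem_stabilizer_iff]
    · rw [← map_smul, hg]
    · rw [h, ← map_smul, hg]
    · rw [← map_smul, hg, h]
  have hf : ∀ y z, (glueSetoid N u w).r y z → f y = f z := by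
    rintro y z (rfl | ⟨n, m, hn, hm, hnm⟩)
    · rfl
    · have h1 : f y = n • f u := by
        rcases hn with rfl | rfl <;> rw [map_smul]
        rw [h]
      have h2 : f z = m • f u := by
        rcases hm with rfl | rfl <;> rw [map_smul]
        rw [h]
      rw [h1, h2, eq_comm, ← inv_smul_eq_iff, ← mul_smul]
      exact hH hnm
  refine ⟨⟨Quotient.lift f hf, ?_⟩, fun _ => rfl⟩
  rintro g ⟨y⟩
  exact map_smul f g y

theorem OrbitBound.exists_rep {k : ℤ} (h : OrbitBound N X k) (u w : X) :
    ∃ (ι : Type u) (_ : Fintype ι) (x : ι → X) (S : ι → Finset N),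
      (∀ y, ∃ i, ∃ n : N, n • x i = y) ∧ (∀ i j, ∀ n : N, n • x i = x j → i = j) ∧
      (∀ i, Subgroup.closure (S i : Set N) = stabilizer N (x i)) ∧
      ∑ i, (((S i).card : ℤ) - 1) ≤ k ∧
      ∃ i, x i = u ∧ ((∃ g : N, g • u = w) ∨ ∃ j, j ≠ i ∧ x j = w) := by
  classical
  obtain ⟨ι, _, x, S, hx, hinj, hS, hk⟩ := h
  have key : ∀ g : ι → N, ∃ S' : ι → Finset N,
      (∀ y, ∃ i, ∃ n : N, n • g i • x i = y) ∧ (∀ i j, ∀ n : N, n • g i • x i = g j • x j → i = j) ∧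
      (∀ i, Subgroup.closure (S' i : Set N) = stabilizer N (g i • x i)) ∧
      ∑ i, (((S' i).card : ℤ) - 1) ≤ k := by
    intro g
    refine ⟨fun i => (S i).image (MulAut.conj (g i)), fun y => ?_, fun i j n hn => ?_,
      fun i => ?_, le_trans (Finset.sum_le_sum fun i _ => ?_) hk⟩
    · obtain ⟨i, n, hn⟩ := hx y
      exact ⟨i, n * (g i)⁻¹, by simp [mul_smul, hn]⟩
    · refine hinj i j ((g j)⁻¹ * n * g i) ?_
      rw [mul_smul, mul_smul, hn, inv_smul_smul]
    · rw [stabilizer_smul_eq_stabilizer_map_conj, ← hS, MonoidHom.map_closure]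
      simp
    · exact sub_le_sub_right (Nat.cast_le.2 Finset.card_image_le) 1
  obtain ⟨i, n, hn⟩ := hx u
  obtain ⟨j, m, hm⟩ := hx w
  obtain ⟨S', h1, h2, h3, h4⟩ := key (Function.update (fun _ => m) i n)
  refine ⟨ι, _, _, S', h1, h2, h3, h4, i, by simp [hn], ?_⟩
  by_cases hij : j = i
  · subst hij
    exact Or.inl ⟨m * n⁻¹, by rw [← hn, ← hm, mul_smul, inv_smul_smul]⟩
  · exact Or.inr ⟨j, hij, by simp [hij, hm]⟩

/-- Identifying two points equivariantly raises the bound by at most one. -/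
theorem OrbitBound.glue {k : ℤ} (h : OrbitBound N X k) (u w : X) :
    OrbitBound N (Glue N u w) (k + 1) := by
  classical
  obtain ⟨ι, _, x, S, hx, hinj, hS, hk, i, rfl, ⟨g, rfl⟩ | ⟨j, hji, rfl⟩⟩ := h.exists_rep u w
  · have away : ∀ k, k ≠ i → ∀ z, ∀ m : N, Glue.mk N (x i) (g • x i) (m • x k) =
        Glue.mk N (x i) (g • x i) z → m • x k = z := by
      intro k hki z m
      refine Glue.eq_of_mk_eq_mk (fun n hn => hki ?_) (fun n hn => hki ?_)
      · exact (hinj i k (m⁻¹ * n) (by rw [mul_smul, hn, inv_smul_smul])).symm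
      · exact (hinj i k (m⁻¹ * n * g) (by rw [mul_smul, mul_smul, hn, inv_smul_smul])).symm
    refine ⟨ι, inferInstance, fun k => Glue.mk N _ _ (x k),
      Function.update S i (insert g (S i)), ?_, ?_, ?_, ?_⟩
    · intro y
      obtain ⟨y, rfl⟩ := Glue.mk_surjective _ _ y
      obtain ⟨k, n, rfl⟩ := hx y
      exact ⟨k, n, rfl⟩
    · intro k l n hn
      dsimp only at hn
      by_cases hki : k = i
      · by_cases hli : l = i
        · rw [hki, hli]
        · rw [← one_smul N (x l)] at hn
          have := away l hli _ _ hn.symm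
          exact hinj _ _ n (by simpa using this.symm)
      · exact hinj _ _ _ (away k hki _ _ hn)
    · intro k
      by_cases hki : k = i
      · subst hki
        rw [Function.update_self, Glue.stabilizer_mk]
        apply le_antisymm
        · rw [Finset.coe_insert, Subgroup.closure_le, Set.insert_subset_iff]
          refine ⟨Subgroup.subset_closure (Or.inr (Or.inr rfl)), fun s hs => ?_⟩
          exact Subgroup.subset_closure (Or.inl ((hS k).le (Subgroup.subset_closure hs)))
        · have hg : g ∈ Subgroup.closure (↑(insert g (S k)) : Set N) :=
            Subgroup.subset_closure (by simp)
          have hst : stabilizer N (x k) ≤ Subgroup.closure (↑(insert g (S k)) : Set N) := by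
            rw [← hS]
            exact Subgroup.closure_mono (by simp)
          refine (Subgroup.closure_le _).2 ?_
          rintro n (hn | hn | hn)
          · exact hst hn
          · have : g⁻¹ * n * g ∈ stabilizer N (x k) := by
              rw [mem_stabilizer_iff, mul_smul, mul_smul, hn, inv_smul_smul]
            simpa [mul_assoc] using mul_mem (mul_mem hg (hst this)) (inv_mem hg)
          · have : g⁻¹ * n ∈ stabilizer N (x k) := by
              rw [mem_stabilizer_iff, mul_smul, hn, inv_smul_smul]
            simpa using mul_mem hg (hst this)
      · rw [Function.update_of_ne hki, hS]
        ext n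
        simp only [mem_stabilizer_iff, Glue.smul_mk]
        exact ⟨fun h => by rw [h], away k hki _ _⟩
    · have : ∀ k, ((Function.update S i (insert g (S i)) k).card : ℤ) - 1 ≤
          ((S k).card - 1) + if k = i then 1 else 0 := by
        intro k
        by_cases hki : k = i
        · subst hki
          have := Finset.card_insert_le g (S k)
          simp only [Function.update_self, if_true]
          omega
        · simp [hki]
      refine (Finset.sum_le_sum fun k _ => this k).trans ?_
      rw [Finset.sum_add_distrib]
      simpa using hk
  · have away : ∀ k, k ≠ i → k ≠ j → ∀ z, ∀ m : N, Glue.mk N (x i) (x j) (m • x k) =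
        Glue.mk N (x i) (x j) z → m • x k = z := by
      intro k hki hkj z m
      refine Glue.eq_of_mk_eq_mk (fun n hn => hki ?_) (fun n hn => hkj ?_)
      · exact (hinj i k (m⁻¹ * n) (by rw [mul_smul, hn, inv_smul_smul])).symm
      · exact (hinj j k (m⁻¹ * n) (by rw [mul_smul, hn, inv_smul_smul])).symm
    refine ⟨{k // k ≠ j}, inferInstance, fun k => Glue.mk N _ _ (x k),
      fun k => if k.1 = i then S i ∪ S j else S k, ?_, ?_, ?_, ?_⟩
    · intro y
      obtain ⟨y, rfl⟩ := Glue.mk_surjective _ _ y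
      obtain ⟨k, n, rfl⟩ := hx y
      by_cases hkj : k = j
      · refine ⟨⟨i, hji.symm⟩, n, ?_⟩
        rw [hkj]
        exact congrArg (n • ·) (Glue.mk_left_eq_mk_right (x i) (x j))
      · exact ⟨⟨k, hkj⟩, n, rfl⟩
    · rintro ⟨k, hkj⟩ ⟨l, hlj⟩ n hn
      rw [Subtype.mk.injEq]
      dsimp only at hn
      by_cases hki : k = i
      · by_cases hli : l = i
        · rw [hki, hli]
        · rw [← one_smul N (x l)] at hn
          have := away l hli hlj _ _ hn.symm
          exact hinj _ _ n (by simpa using this.symm)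
      · exact hinj _ _ _ (away k hki hkj _ _ hn)
    · rintro ⟨k, hkj⟩
      by_cases hki : k = i
      · subst hki
        simp only [if_true]
        rw [Glue.stabilizer_mk, Finset.coe_union, Subgroup.closure_union, hS, hS]
        apply le_antisymm
        · refine sup_le (fun n hn => ?_) (fun n hn => ?_)
          · exact Subgroup.subset_closure (Or.inl hn)
          · exact Subgroup.subset_closure (Or.inr (Or.inl hn))
        · refine (Subgroup.closure_le _).2 ?_
          rintro n (hn | hn | hn)
          · exact Subgroup.mem_sup_left hn
          · exact Subgroup.mem_sup_right hn
          · exact absurd (hinj _ _ _ hn).symm hji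
      · simp only [if_neg hki]
        rw [hS]
        ext n
        simp only [mem_stabilizer_iff, Glue.smul_mk]
        exact ⟨fun h => by rw [h], away k hki hkj _ _⟩
    · have : ∀ k : {k // k ≠ j}, (((if k.1 = i then S i ∪ S j else S k).card : ℤ)) - 1 ≤
          ((S k).card - 1) + if k = ⟨i, hji.symm⟩ then ((S j).card : ℤ) else 0 := by
        rintro ⟨k, hkj⟩
        by_cases hki : k = i
        · subst hki
          have := Finset.card_union_le (S k) (S j)
          simp only [if_true]
          omega
        · simp [hki]
      refine (Finset.sum_le_sum fun k _ => this k).trans ?_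
      rw [Finset.sum_add_distrib]
      rw [Fintype.sum_eq_add_sum_subtype_ne _ j] at hk
      simp only [Finset.sum_ite_eq', Finset.mem_univ, if_true]
      omega

end Glue

section EdgeRel

variable (N : Type u) [Group N] {X : Type u} [MulAction N X]

/-- The adjacency relation whose edges are the `N`-translates of the members of `E`. -/
def EdgeRel (E : Finset (Sym2 X)) (x y : X) : Prop :=
  ∃ e ∈ E, ∃ n : N, s(x, y) = e.map (n • ·)

/-- Any two points are joined by a chain of `N`-translates of members of `E`. -/
def EdgeConnected (E : Finset (Sym2 X)) : Prop :=
  ∀ x y, Relation.EqvGen (EdgeRel N E) x y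

variable {N}

theorem Sym2.mk_inv_smul_eq {x y : X} {e : Sym2 X} {n : N} (h : s(x, y) = e.map (n • ·)) :
    s(n⁻¹ • x, n⁻¹ • y) = e := by
  have := congrArg (Sym2.map (n⁻¹ • ·)) h
  rw [Sym2.map_mk, Sym2.map_map] at this
  rw [this, show ((n⁻¹ • ·) ∘ (n • ·) : X → X) = id from funext (inv_smul_smul n),
    Sym2.map_id, id]

theorem EdgeRel.symm {E : Finset (Sym2 X)} {x y : X} (h : EdgeRel N E x y) : EdgeRel N E y x := by
  obtain ⟨e, he, n, hn⟩ := h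
  exact ⟨e, he, n, Sym2.eq_swap.trans hn⟩

theorem EdgeRel.smul {E : Finset (Sym2 X)} {x y : X} (h : EdgeRel N E x y) (g : N) :
    EdgeRel N E (g • x) (g • y) := by
  obtain ⟨e, he, n, hn⟩ := h
  refine ⟨e, he, g * n, ?_⟩
  have := congrArg (Sym2.map (g • ·)) hn
  rw [Sym2.map_mk, Sym2.map_map] at this
  rw [this]
  congr 1
  funext z
  simp [mul_smul]

theorem EdgeRel.map {Y : Type u} [MulAction N Y] {E : Finset (Sym2 X)} {E' : Finset (Sym2 Y)}
    (π : X →[N] Y) (hE : ∀ e ∈ E, e.map π ∈ E') {x y : X} (h : EdgeRel N E x y) :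
    EdgeRel N E' (π x) (π y) := by
  obtain ⟨e, he, n, hn⟩ := h
  refine ⟨_, hE e he, n, ?_⟩
  have := congrArg (Sym2.map π) hn
  rw [Sym2.map_mk, Sym2.map_map] at this
  rw [this, Sym2.map_map]
  congr 1
  funext z
  simp

theorem Relation.EqvGen.map_of {α β : Type*} {r : α → α → Prop} {r' : β → β → Prop} (π : α → β)
    (h : ∀ x y, r x y → Relation.EqvGen r' (π x) (π y)) {x y : α} (hxy : Relation.EqvGen r x y) :
    Relation.EqvGen r' (π x) (π y) := by
  induction hxy with
  | rel x y hr => exact h x y hr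
  | refl x => exact .refl _
  | symm x y _ ih => exact .symm _ _ ih
  | trans x y z _ _ ih₁ ih₂ => exact .trans _ _ _ ih₁ ih₂

theorem eqvGen_edgeRel_smul {E : Finset (Sym2 X)} {x y : X}
    (h : Relation.EqvGen (EdgeRel N E) x y) (g : N) :
    Relation.EqvGen (EdgeRel N E) (g • x) (g • y) :=
  Relation.EqvGen.map_of (g • ·) (fun _ _ h => .rel _ _ (h.smul g)) h

variable (N) in
/-- The equivariant projection to `Glue`. -/
def Glue.proj (u w : X) : X →[N] Glue N u w := ⟨Glue.mk N u w, fun _ _ => rfl⟩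

open Classical in
/-- If two points can be joined without the edge `e` after identifying `u` and `w`, then `e` may be
dropped when performing the identification. -/
theorem EdgeConnected.glue {E : Finset (Sym2 X)} (hE : EdgeConnected N E) (u w : X) (e : Sym2 X)
    (he : ∀ x y, s(x, y) = e →
      Relation.EqvGen (EdgeRel N ((E.erase e).image (Sym2.map (Glue.proj N u w))))
        (Glue.proj N u w x) (Glue.proj N u w y)) :
    EdgeConnected N ((E.erase e).image (Sym2.map (Glue.proj N u w))) := by
  intro x y
  obtain ⟨x, rfl⟩ := Glue.mk_surjective u w x
  obtain ⟨y, rfl⟩ := Glue.mk_surjective u w y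
  refine Relation.EqvGen.map_of (Glue.proj N u w) (fun x y h => ?_) (hE x y)
  obtain ⟨e', he', n, hn⟩ := h
  by_cases hee : e' = e
  · subst hee
    simpa using eqvGen_edgeRel_smul (he _ _ (Sym2.mk_inv_smul_eq hn)) n
  · exact .rel _ _ (EdgeRel.map (E := E.erase e) _
      (fun e he => Finset.mem_image_of_mem _ he) ⟨e', by simp [hee, he'], n, hn⟩)

/-- A group acting on a connected graph, with orbits bounded by `k` and `m` orbits of edges, is
generated by `k + m + 1` elements. -/
theorem OrbitBound.exists_generators [Nonempty X] {k : ℤ} (hk : OrbitBound N X k)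
    {E : Finset (Sym2 X)} (hE : EdgeConnected N E) :
    ∃ S : Finset N, Subgroup.closure (S : Set N) = ⊤ ∧ (S.card : ℤ) - 1 ≤ k + E.card := by
  classical
  induction hm : E.card using Nat.strong_induction_on generalizing X k with
  | _ m ih =>
  subst hm
  rcases E.eq_empty_or_nonempty with rfl | ⟨e, he⟩
  · have hsub : ∀ x y : X, x = y := by
      intro x y
      have := hE x y
      induction this with
      | rel _ _ h => obtain ⟨e, he, -⟩ := h; simp at he
      | refl => rfl
      | symm _ _ _ ih => exact ih.symm
      | trans _ _ _ _ _ ih₁ ih₂ => exact ih₁.trans ih₂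
    obtain ⟨ι, _, x, S, hx, hinj, hS, hk⟩ := hk
    obtain ⟨i, -⟩ := hx (Classical.arbitrary X)
    refine ⟨S i, ?_, ?_⟩
    · rw [hS, eq_top_iff]
      exact fun n _ => hsub _ _
    · rw [Fintype.sum_eq_single i fun j hj => absurd (hinj j i 1 (hsub _ _)) hj] at hk
      simpa using hk
  · induction e using Sym2.ind with
    | _ u w =>
    have hcard : ((E.erase s(u, w)).image (Sym2.map (Glue.proj N u w))).card ≤ E.card - 1 :=
      Finset.card_image_le.trans (Finset.card_erase_of_mem he).le
    have hpos : 0 < E.card := Finset.card_pos.2 ⟨_, he⟩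
    have : Nonempty (Glue N u w) := ⟨Glue.mk N u w u⟩
    obtain ⟨S, hS, hS'⟩ := ih _ (by omega) (hk.glue u w) (hE.glue u w s(u, w) (by
      intro x y hxy
      have e := Glue.mk_left_eq_mk_right (N := N) u w
      rcases Sym2.eq_iff.1 hxy with ⟨rfl, rfl⟩ | ⟨rfl, rfl⟩
      · change Relation.EqvGen _ (Glue.mk N _ _ _) (Glue.mk N _ _ _)
        rw [e]
        exact .refl _
      · change Relation.EqvGen _ (Glue.mk N _ _ _) (Glue.mk N _ _ _)
        rw [e]
        exact .refl _)) rfl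
    exact ⟨S, hS, by omega⟩

end EdgeRel

theorem OrbitBound.regular (N : Type u) [Group N] : OrbitBound N N (-1) :=
  ⟨PUnit, inferInstance, fun _ => 1, fun _ => ∅, fun y => ⟨PUnit.unit, y, by simp⟩,
    fun _ _ _ _ => rfl, fun _ => by
      rw [Finset.coe_empty, Subgroup.closure_empty, eq_comm, eq_bot_iff]
      intro n hn
      simpa using hn, by simp⟩

theorem OrbitBound.sum_regular {N : Type u} [Group N] {X : Type u} [MulAction N X] {k : ℤ}
    (h : OrbitBound N X k) : OrbitBound N (X ⊕ N) (k - 1) := by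
  obtain ⟨ι, _, x, S, hx, hinj, hS, hk⟩ := h
  refine ⟨Option ι, inferInstance, fun i => i.elim (Sum.inr 1) (fun i => Sum.inl (x i)),
    fun i => i.elim ∅ S, ?_, ?_, ?_, ?_⟩
  · rintro (y | n)
    · obtain ⟨i, n, hn⟩ := hx y
      exact ⟨some i, n, congrArg Sum.inl hn⟩
    · exact ⟨none, n, congrArg Sum.inr (mul_one n)⟩
  · rintro (_ | i) (_ | j) n hn
    · rfl
    · simp at hn
    · simp at hn
    · exact congrArg some (hinj i j n (Sum.inl_injective hn))
  · rintro (_ | i)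
    · simp only [Option.elim]
      rw [Finset.coe_empty, Subgroup.closure_empty, eq_comm, eq_bot_iff]
      intro n hn
      have := Sum.inr_injective (mem_stabilizer_iff.1 hn)
      simpa using this
    · simp only [Option.elim]
      rw [hS]
      ext n
      simp [mem_stabilizer_iff]
  · rw [Fintype.sum_option]
    simp only [Option.elim, Finset.card_empty]
    push_cast
    linarith

variable {N : Type u} [Group N] {V : Type v} [MulAction N V]

variable (N) in
/-- An `N`-set `X` with an equivariant map to the vertices of `T` and finitely many edge
representatives that are mapped to edges of `T`. -/
structure MarkedGraph (T : SimpleGraph V) where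
  X : Type u
  [action : MulAction N X]
  f : X →[N] V
  E : Finset (Sym2 X)
  map_mem : ∀ e ∈ E, e.map f ∈ T.edgeSet

attribute [instance] MarkedGraph.action

namespace MarkedGraph

variable {T : SimpleGraph V}

/-- An upper bound for the number of generators visible in the marked graph, minus one. -/
def Bounded (Y : MarkedGraph N T) (c : ℤ) : Prop :=
  ∃ k, OrbitBound N Y.X k ∧ k + Y.E.card ≤ c

/-- Gluing two vertices with the same image, optionally dropping some edges. -/
theorem exists_glue (Y : MarkedGraph N T) {u w : Y.X} (h : Y.f u = Y.f w) :
    ∃ f' : Glue N u w →[N] V, (∀ x, f' (Glue.proj N u w x) = Y.f x) ∧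
      ∀ e ∈ Y.E, (e.map (Glue.proj N u w)).map f' ∈ T.edgeSet := by
  obtain ⟨f', hf'⟩ := Glue.exists_lift Y.f h
  refine ⟨f', hf', fun e he => ?_⟩
  rw [Sym2.map_map, show f' ∘ Glue.proj N u w = Y.f from funext hf']
  exact Y.map_mem e he

/-- Joining two vertices by a path raises the bound by at most one. -/
theorem exists_join {v v' : V} (p : T.Walk v v') (Y : MarkedGraph N T) (u w : Y.X)
    (hu : Y.f u = v) (hw : Y.f w = v') {c : ℤ}
    (hc : Y.Bounded c) :
    ∃ (Y' : MarkedGraph N T) (π : Y.X →[N] Y'.X), (∀ x, Y'.f (π x) = Y.f x) ∧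
      (∀ x y, Relation.EqvGen (EdgeRel N Y.E) x y → Relation.EqvGen (EdgeRel N Y'.E) (π x) (π y)) ∧
      Relation.EqvGen (EdgeRel N Y'.E) (π u) (π w) ∧
      (∀ x', ∃ x, Relation.EqvGen (EdgeRel N Y'.E) x' (π x)) ∧ Y'.Bounded (c + 1) := by
  classical
  induction p generalizing Y c with
  | nil =>
    obtain ⟨f', hf', hE⟩ := Y.exists_glue (hu.trans hw.symm)
    refine ⟨⟨Glue N u w, f', Y.E.image (Sym2.map (Glue.proj N u w)), ?_⟩, Glue.proj N u w, hf', ?_,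
      ?_, fun x' => ?_, ?_⟩
    · simpa using hE
    · exact fun x y => Relation.EqvGen.map_of _ fun x y h =>
        .rel _ _ (h.map _ fun e he => Finset.mem_image_of_mem _ he)
    · rw [show Glue.proj N u w u = Glue.proj N u w w from Glue.mk_left_eq_mk_right u w]
      exact .refl _
    · obtain ⟨x, rfl⟩ := Glue.mk_surjective u w x'
      exact ⟨x, .refl _⟩
    · obtain ⟨k, hk, hkc⟩ := hc
      refine ⟨k + 1, hk.glue u w, ?_⟩
      have : (Y.E.image (Sym2.map (Glue.proj N u w))).card ≤ Y.E.card := Finset.card_image_le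
      dsimp only
      omega
  | @cons v t v' hvt p ih =>
    let inl : Y.X →[N] Y.X ⊕ N := ⟨Sum.inl, fun _ _ => rfl⟩
    let f₁ : Y.X ⊕ N →[N] V := ⟨Sum.elim Y.f (fun n => n • t), by
      rintro n (x | m)
      · exact map_smul Y.f n x
      · exact mul_smul n m t⟩
    let Y₁ : MarkedGraph N T :=
      { X := Y.X ⊕ N
        f := f₁
        E := insert s(Sum.inl u, Sum.inr 1) (Y.E.image (Sym2.map inl))
        map_mem := by
          intro e he
          rcases Finset.mem_insert.1 he with rfl | he
          · change T.Adj (Y.f u) ((1 : N) • t)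
            rwa [hu, one_smul]
          · obtain ⟨e', he', rfl⟩ := Finset.mem_image.1 he
            rw [Sym2.map_map]
            exact Y.map_mem e' he' }
    have hY₁ : Y₁.Bounded c := by
      obtain ⟨k, hk, hkc⟩ := hc
      refine ⟨k - 1, hk.sum_regular, ?_⟩
      have h1 : Y₁.E.card ≤ (Y.E.image (Sym2.map inl)).card + 1 := Finset.card_insert_le _ _
      have h2 : (Y.E.image (Sym2.map inl)).card ≤ Y.E.card := Finset.card_image_le
      omega
    obtain ⟨Y', π, hf, hπ, huw, hsurj, hb⟩ := ih Y₁ (Sum.inr 1) (Sum.inl w) (one_smul N t) hw hY₁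
    have hedge : Relation.EqvGen (EdgeRel N Y₁.E) (Sum.inl u : Y.X ⊕ N) (Sum.inr 1 : Y.X ⊕ N) :=
      .rel _ _ ⟨_, Finset.mem_insert_self _ _, 1, by simp⟩
    refine ⟨Y', π.comp inl, fun x => hf _, fun x y hxy => hπ _ _ ?_, ?_, fun x' => ?_, hb⟩
    · exact Relation.EqvGen.map_of inl (fun x y h => .rel _ _ (h.map inl fun e he =>
        Finset.mem_insert_of_mem (Finset.mem_image_of_mem _ he))) hxy
    · exact .trans _ _ _ (hπ _ _ hedge) huw
    · obtain ⟨x | n, hx⟩ := hsurj x'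
      · exact ⟨x, hx⟩
      · refine ⟨n • u, .trans _ _ _ hx (hπ _ _ (.symm _ _ ?_))⟩
        have := eqvGen_edgeRel_smul hedge n
        rwa [show n • (Sum.inr 1 : Y.X ⊕ N) = Sum.inr n from congrArg Sum.inr (mul_one n)] at this

/-- A group generated by `S` admits a connected marked graph with bound `|S| - 1`. -/
theorem exists_edgeConnected (hconn : T.Connected) (S : Finset N)
    (hS : Subgroup.closure (S : Set N) = ⊤) :
    ∃ Y : MarkedGraph N T, Nonempty Y.X ∧ EdgeConnected N Y.E ∧ Y.Bounded (S.card - 1) := by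
  classical
  obtain ⟨v₀⟩ := hconn.nonempty
  have key : ∀ S : Finset N, ∃ (Y : MarkedGraph N T) (x₀ : Y.X),
      (∀ s ∈ S, Relation.EqvGen (EdgeRel N Y.E) x₀ (s • x₀)) ∧
      (∀ x, ∃ g : N, Relation.EqvGen (EdgeRel N Y.E) x (g • x₀)) ∧ Y.Bounded (S.card - 1) := by
    intro S
    induction S using Finset.induction_on with
    | empty =>
      let f : N →[N] V := ⟨fun n => n • v₀, fun n m => mul_smul n m v₀⟩
      refine ⟨⟨N, f, ∅, by simp⟩, (1 : N), by simp, fun x => ⟨x, ?_⟩, -1, .regular N, by simp⟩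
      rw [show x • (1 : N) = x from mul_one x]
      exact .refl _
    | insert s S hs ih =>
      obtain ⟨Y, x₀, h1, h2, h3⟩ := ih
      obtain ⟨p⟩ := hconn.preconnected (Y.f x₀) (Y.f (s • x₀))
      obtain ⟨Y', π, -, hπ, huw, hsurj, hb⟩ := exists_join p Y x₀ (s • x₀) rfl rfl h3
      refine ⟨Y', π x₀, fun s' hs' => ?_, fun x' => ?_, ?_⟩
      · rw [← map_smul]
        rcases Finset.mem_insert.1 hs' with rfl | hs'
        · exact huw
        · exact hπ _ _ (h1 s' hs')
      · obtain ⟨x, hx⟩ := hsurj x'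
        obtain ⟨g, hg⟩ := h2 x
        exact ⟨g, .trans _ _ _ hx (by rw [← map_smul]; exact hπ _ _ hg)⟩
      · rw [Finset.card_insert_of_notMem hs]
        convert hb using 1
        push_cast
        ring
  obtain ⟨Y, x₀, h1, h2, h3⟩ := key S
  refine ⟨Y, ⟨x₀⟩, ?_, h3⟩
  have h4 : ∀ g : N, Relation.EqvGen (EdgeRel N Y.E) x₀ (g • x₀) := by
    intro g
    have hg : g ∈ Subgroup.closure (S : Set N) := hS ▸ Subgroup.mem_top g
    induction hg using Subgroup.closure_induction with
    | mem s hs => exact h1 s hs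
    | one => rw [one_smul]; exact .refl _
    | mul g h _ _ ih₁ ih₂ =>
      rw [mul_smul]
      exact .trans _ _ _ ih₁ (eqvGen_edgeRel_smul ih₂ g)
    | inv g _ ih =>
      have := eqvGen_edgeRel_smul ih g⁻¹
      rw [inv_smul_smul] at this
      exact .symm _ _ this
  intro x y
  obtain ⟨g, hg⟩ := h2 x
  obtain ⟨h, hh⟩ := h2 y
  exact .trans _ _ _ hg (.trans _ _ _ (.symm _ _ (h4 g)) (.trans _ _ _ (h4 h) (.symm _ _ hh)))

end MarkedGraph

theorem SimpleGraph.IsAcyclic.isPath_map_of_locally_injective {X V : Type*} {G : SimpleGraph X}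
    {T : SimpleGraph V} (hT : T.IsAcyclic) (f : G →g T)
    (hf : ∀ x y z, G.Adj x y → G.Adj x z → f y = f z → y = z) {x y : X} {p : G.Walk x y}
    (hp : p.IsPath) : (p.map f).IsPath := by
  induction p with
  | nil => simp
  | @cons u v w h p ih =>
    rw [SimpleGraph.Walk.cons_isPath_iff] at hp
    rw [SimpleGraph.Walk.map_cons, SimpleGraph.Walk.cons_isPath_iff]
    refine ⟨ih hp.1, fun hmem => ?_⟩
    have h1 := hT.eq_snd_of_adj_start (ih hp.1) (f.map_adj h.symm) hmem
    cases p with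
    | nil => exact (f.map_adj h).ne (by simpa using h1)
    | @cons _ v' _ h' p =>
      have h2 : u = v' := hf v u v' h.symm h' (by simpa using h1)
      subst h2
      exact hp.2 (by simp)

variable {N : Type u} [Group N] {V : Type v} [MulAction N V] {T : SimpleGraph V}

/-- A set of vertices is path-convex if it contains every path between any two of its members. -/
def SimpleGraph.PathConvex {V : Type*} (T : SimpleGraph V) (Y : Set V) : Prop :=
  ∀ ⦃x y : V⦄ (p : T.Walk x y), p.IsPath → x ∈ Y → y ∈ Y → ∀ z ∈ p.support, z ∈ Y

namespace MarkedGraph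

theorem adj_map (hT : ∀ (n : N) v w, T.Adj v w → T.Adj (n • v) (n • w))
    {Y : MarkedGraph N T} {x y : Y.X} (h : EdgeRel N Y.E x y) :
    T.Adj (Y.f x) (Y.f y) := by
  obtain ⟨e, he, n, hn⟩ := h
  have h1 := Y.map_mem e he
  rw [← Sym2.mk_inv_smul_eq hn, Sym2.map_mk, map_smul, map_smul, SimpleGraph.mem_edgeSet] at h1
  simpa using hT n _ _ h1

/-- The graph structure on a marked graph. -/
def graph (hT : ∀ (n : N) v w, T.Adj v w → T.Adj (n • v) (n • w))
    (Y : MarkedGraph N T) : SimpleGraph Y.X where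
  Adj := EdgeRel N Y.E
  symm := ⟨fun _ _ h => h.symm⟩
  loopless := ⟨fun _ h => (adj_map hT h).ne rfl⟩

/-- The marking as a graph homomorphism. -/
def hom (hT : ∀ (n : N) v w, T.Adj v w → T.Adj (n • v) (n • w))
    (Y : MarkedGraph N T) : Y.graph hT →g T := ⟨Y.f, fun h => adj_map hT h⟩

/-- A connected marked graph can be folded to one that is locally injective over `T`. -/
theorem exists_locally_injective
    (hT : ∀ (n : N) v w, T.Adj v w → T.Adj (n • v) (n • w))
    (hfree : ∀ (n : N) v w, T.Adj v w → s(n • v, n • w) = s(v, w) → n = 1)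
    (Y : MarkedGraph N T) (hne : Nonempty Y.X) (hY : EdgeConnected N Y.E) {c : ℤ}
    (hc : Y.Bounded c) :
    ∃ Y' : MarkedGraph N T, Nonempty Y'.X ∧ EdgeConnected N Y'.E ∧ Y'.Bounded c ∧
      ∀ x y z, EdgeRel N Y'.E x y → EdgeRel N Y'.E x z → Y'.f y = Y'.f z → y = z := by
  classical
  induction hm : Y.E.card using Nat.strong_induction_on generalizing Y with
  | _ m ih =>
  subst hm
  by_cases hfold : ∃ e₁ ∈ Y.E, ∃ e₂ ∈ Y.E, e₁ ≠ e₂ ∧ ∃ (n₁ n₂ : N) (x y₁ y₂ : Y.X),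
      s(x, y₁) = e₁.map (n₁ • ·) ∧ s(x, y₂) = e₂.map (n₂ • ·) ∧ Y.f y₁ = Y.f y₂
  · obtain ⟨e₁, he₁, e₂, he₂, hne', n₁, n₂, x, y₁, y₂, h₁, h₂, hf⟩ := hfold
    obtain ⟨f', hf', hE⟩ := Y.exists_glue hf
    have hcard : ((Y.E.erase e₂).image (Sym2.map (Glue.proj N y₁ y₂))).card ≤ Y.E.card - 1 :=
      Finset.card_image_le.trans (Finset.card_erase_of_mem he₂).le
    have hpos : 0 < Y.E.card := Finset.card_pos.2 ⟨_, he₂⟩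
    have hrel : EdgeRel N ((Y.E.erase e₂).image (Sym2.map (Glue.proj N y₁ y₂)))
        (Glue.proj N y₁ y₂ x) (Glue.proj N y₁ y₂ y₂) := by
      rw [← show Glue.proj N y₁ y₂ y₁ = Glue.proj N y₁ y₂ y₂ from Glue.mk_left_eq_mk_right y₁ y₂]
      exact EdgeRel.map (E := Y.E.erase e₂) _ (fun e he => Finset.mem_image_of_mem _ he)
        ⟨e₁, Finset.mem_erase.2 ⟨hne', he₁⟩, n₁, h₁⟩
    refine ih _ ?_ ⟨Glue N y₁ y₂, f', (Y.E.erase e₂).image (Sym2.map (Glue.proj N y₁ y₂)), ?_⟩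
      ⟨Glue.mk N y₁ y₂ x⟩ (hY.glue y₁ y₂ e₂ fun a b hab => ?_) ?_ rfl
    · dsimp only
      omega
    · intro e he
      obtain ⟨e, he', rfl⟩ := Finset.mem_image.1 he
      exact hE e (Finset.mem_of_mem_erase he')
    · have h := hrel.smul n₂⁻¹
      rw [← map_smul, ← map_smul] at h
      rw [← Sym2.mk_inv_smul_eq h₂] at hab
      rcases Sym2.eq_iff.1 hab with ⟨rfl, rfl⟩ | ⟨rfl, rfl⟩
      · exact .rel _ _ h
      · exact .rel _ _ h.symm
    · obtain ⟨k, hk, hkc⟩ := hc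
      refine ⟨k + 1, hk.glue y₁ y₂, ?_⟩
      dsimp only
      omega
  · refine ⟨Y, hne, hY, hc, ?_⟩
    rintro x y z ⟨e₁, he₁, n₁, h₁⟩ ⟨e₂, he₂, n₂, h₂⟩ hf
    have hee : e₁ = e₂ := by
      by_contra hee
      exact hfold ⟨e₁, he₁, e₂, he₂, hee, n₁, n₂, x, y, z, h₁, h₂, hf⟩
    subst hee
    have h := congrArg (Sym2.map (n₂ • ·)) <| congrArg (Sym2.map Y.f) <|
      (Sym2.mk_inv_smul_eq h₁).trans (Sym2.mk_inv_smul_eq h₂).symm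
    simp only [Sym2.map_mk, map_smul, smul_inv_smul, ← hf, ← mul_smul n₂ n₁⁻¹] at h
    have hn := hfree _ _ _ (adj_map hT ⟨e₁, he₁, n₁, h₁⟩) h
    rw [mul_inv_eq_one] at hn
    subst hn
    exact Sym2.congr_right.1 (h₁.trans h₂.symm)

/-- A group generated by `S` acting on a tree with trivial edge stabilizers preserves a subtree
with orbit data bounded by `|S| - 1`. -/
theorem exists_subtree (hT : ∀ (n : N) v w, T.Adj v w → T.Adj (n • v) (n • w))
    (hfree : ∀ (n : N) v w, T.Adj v w → s(n • v, n • w) = s(v, w) → n = 1)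
    (hTree : T.IsTree) (S : Finset N) (hS : Subgroup.closure (S : Set N) = ⊤) :
    ∃ Y : MarkedGraph N T, Nonempty Y.X ∧ Y.Bounded (S.card - 1) ∧ Function.Injective Y.f ∧
      T.PathConvex (Set.range Y.f) ∧ ∀ x y, T.Adj (Y.f x) (Y.f y) → EdgeRel N Y.E x y := by
  obtain ⟨Y₀, hne₀, hY₀, hb₀⟩ := exists_edgeConnected (T := T) hTree.connected S hS
  obtain ⟨Y, hne, hY, hb, hinj⟩ := exists_locally_injective hT hfree Y₀ hne₀ hY₀ hb₀
  have hpath : ∀ x y, ∃ p : (Y.graph hT).Walk x y, (p.map (Y.hom hT)).IsPath := by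
    intro x y
    have : (Y.graph hT).Reachable x y := by
      induction hY x y with
      | rel x y h => exact SimpleGraph.Adj.reachable (G := Y.graph hT) h
      | refl => rfl
      | symm _ _ _ ih => exact ih.symm
      | trans _ _ _ _ _ ih₁ ih₂ => exact ih₁.trans ih₂
    obtain ⟨p, hp⟩ := this.exists_isPath
    exact ⟨p, hTree.isAcyclic.isPath_map_of_locally_injective (Y.hom hT) hinj hp⟩
  have huniq : ∀ {v w : V} (p q : T.Walk v w), p.IsPath → q.IsPath → p = q :=
    fun p q hp hq => congrArg Subtype.val
      ((hTree.isAcyclic.subsingleton_path _ _).elim ⟨p, hp⟩ ⟨q, hq⟩)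
  refine ⟨Y, hne, hb, fun x y hxy => ?_, ?_, fun x y hxy => ?_⟩
  · obtain ⟨p, hp⟩ := hpath x y
    cases p with
    | nil => rfl
    | cons h p =>
      rw [SimpleGraph.Walk.map_cons, SimpleGraph.Walk.cons_isPath_iff] at hp
      refine absurd ?_ hp.2
      rw [show Y.hom hT x = Y.hom hT y from hxy]
      exact SimpleGraph.Walk.end_mem_support _
  · rintro _ _ q hq ⟨x, rfl⟩ ⟨y, rfl⟩ z hz
    obtain ⟨p, hp⟩ := hpath x y
    have hz' : z ∈ (p.map (Y.hom hT)).support := huniq q _ hq hp ▸ hz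
    rw [SimpleGraph.Walk.support_map] at hz'
    obtain ⟨t, -, rfl⟩ := List.mem_map.1 hz'
    exact ⟨t, rfl⟩
  · obtain ⟨p, hp⟩ := hpath x y
    have h := congrArg SimpleGraph.Walk.length (huniq _ (SimpleGraph.Walk.cons hxy .nil) hp
      (by simpa using hxy.ne))
    exact SimpleGraph.Walk.adj_of_length_eq_one (G := Y.graph hT) (p := p)
      ((SimpleGraph.Walk.length_map (Y.hom hT) p).symm.trans h)

end MarkedGraph

section MinimalSubtree

variable {V : Type v} {T : SimpleGraph V}

namespace SimpleGraph

theorem Walk.reachable_deleteEdges {x y s t : V} (p : T.Walk x y)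
    (hp : s ∉ p.support ∨ t ∉ p.support) : (T.deleteEdges {s(s, t)}).Reachable x y :=
  ⟨p.toDeleteEdge _ fun h => hp.elim (fun hs => hs (p.fst_mem_support_of_mem_edges h))
    fun ht => ht (p.snd_mem_support_of_mem_edges h)⟩

/-- A walk ending outside `Y` avoids `Y` unless it has a last edge leaving `Y`. -/
theorem Walk.exists_last_exit (Y : Set V) {x z : V} (p : T.Walk x z) (hz : z ∉ Y) :
    (∀ w ∈ p.support, w ∉ Y) ∨
      ∃ s t, s ∈ Y ∧ T.Adj s t ∧ ∃ q : T.Walk t z, ∀ w ∈ q.support, w ∉ Y := by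
  induction p with
  | nil => exact .inl (by simpa using hz)
  | @cons u v w h p ih =>
    rcases ih hz with ih | ih
    · by_cases hu : u ∈ Y
      · exact .inr ⟨u, v, hu, h, p, ih⟩
      · exact .inl (by simpa using ⟨hu, ih⟩)
    · exact .inr ih

variable {N : Type*} [Group N] [MulAction N V]

/-- Two invariant subtrees of a tree meet if the group acts with trivial edge stabilizers. -/
theorem PathConvex.inter_nonempty [Nontrivial N]
    (hT : ∀ (n : N) v w, T.Adj v w → T.Adj (n • v) (n • w))
    (hfree : ∀ (n : N) v w, T.Adj v w → s(n • v, n • w) = s(v, w) → n = 1)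
    (hTree : T.IsTree) {Y Z : Set V} (hY : T.PathConvex Y) (hZ : T.PathConvex Z)
    (hYne : Y.Nonempty) (hZne : Z.Nonempty) (hYinv : ∀ (n : N), ∀ y ∈ Y, n • y ∈ Y)
    (hZinv : ∀ (n : N), ∀ y ∈ Z, n • y ∈ Z) : (Y ∩ Z).Nonempty := by
  by_contra hYZ
  have hdisj : ∀ v ∈ Y, v ∉ Z := fun v hv hv' => hYZ ⟨v, hv, hv'⟩
  have hwalk : ∀ {W : Set V}, T.PathConvex W → ∀ {x y}, x ∈ W → y ∈ W →
      ∃ p : T.Walk x y, ∀ z ∈ p.support, z ∈ W := fun hW x y hx hy =>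
    let ⟨p, hp⟩ := (hTree.connected x y).exists_isPath
    ⟨p, hW p hp hx hy⟩
  obtain ⟨y, hy⟩ := hYne
  obtain ⟨z, hz⟩ := hZne
  obtain ⟨p⟩ := hTree.connected y z
  obtain ⟨s, t, hs, hst, q, hq⟩ := (p.exists_last_exit Y fun h => hdisj z h hz).resolve_left
    fun h => h y p.start_mem_support hy
  obtain ⟨n, hn⟩ := exists_ne (1 : N)
  refine isBridge_iff.1 (isAcyclic_iff_forall_adj_isBridge.1 hTree.isAcyclic hst) ?_
  obtain ⟨p₁, hp₁⟩ := hwalk hY hs (hYinv n s hs)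
  obtain ⟨p₂, hp₂⟩ := hwalk hZ (hZinv n z hz) hz
  let g : T →g T := ⟨(n • ·), hT n _ _⟩
  refine (p₁.reachable_deleteEdges (.inr fun h => hq t q.start_mem_support (hp₁ t h))).trans <|
    (Adj.reachable (v := n • t) ?_).trans <|
    (Walk.reachable_deleteEdges (q.map g) (.inl fun h => ?_)).trans <|
    (p₂.reachable_deleteEdges (.inl fun h => hdisj s hs (hp₂ s h))).trans <|
    q.reverse.reachable_deleteEdges (.inl fun h => hq s (by simpa using h) hs)
  · exact deleteEdges_adj.2 ⟨hT n _ _ hst, fun h => hn (hfree n s t hst h)⟩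
  · rw [Walk.support_map] at h
    obtain ⟨w, hw, rfl⟩ := List.mem_map.1 h
    exact hq w hw (inv_smul_smul n w ▸ hYinv n⁻¹ _ hs)

theorem PathConvex.inter {Y Z : Set V} (hY : T.PathConvex Y) (hZ : T.PathConvex Z) :
    T.PathConvex (Y ∩ Z) :=
  fun _ _ p hp hx hy z hz => ⟨hY p hp hx.1 hy.1 z hz, hZ p hp hx.2 hy.2 z hz⟩

theorem PathConvex.exists_minimal [Nontrivial N]
    (hT : ∀ (n : N) v w, T.Adj v w → T.Adj (n • v) (n • w))
    (hfree : ∀ (n : N) v w, T.Adj v w → s(n • v, n • w) = s(v, w) → n = 1)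
    (hTree : T.IsTree) {Y : Set V} (hY : T.PathConvex Y) (hYne : Y.Nonempty)
    (hYinv : ∀ (n : N), ∀ y ∈ Y, n • y ∈ Y)
    (hYfin : ((Quotient.mk (orbitRel N V)) '' Y).Finite) :
    ∃ Y₀ : Set V, T.PathConvex Y₀ ∧ Y₀.Nonempty ∧ (∀ (n : N), ∀ y ∈ Y₀, n • y ∈ Y₀) ∧
      ∀ Z : Set V, T.PathConvex Z → Z.Nonempty → (∀ (n : N), ∀ y ∈ Z, n • y ∈ Z) → Y₀ ⊆ Z := by
  induction hm : ((Quotient.mk (orbitRel N V)) '' Y).ncard using Nat.strong_induction_on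
    generalizing Y with
  | _ m ih =>
  by_cases h : ∀ Z : Set V, T.PathConvex Z → Z.Nonempty → (∀ (n : N), ∀ y ∈ Z, n • y ∈ Z) → Y ⊆ Z
  · exact ⟨Y, hY, hYne, hYinv, h⟩
  push Not at h
  obtain ⟨Z, hZ, hZne, hZinv, hYZ⟩ := h
  have hsub := Set.image_mono (f := Quotient.mk (orbitRel N V))
    (Set.inter_subset_left (s := Y) (t := Z))
  refine ih _ (hm ▸ Set.ncard_lt_ncard ⟨hsub, fun h => hYZ fun y hy => ?_⟩ hYfin) (hY.inter hZ)
    (hY.inter_nonempty hT hfree hTree hZ hYne hZne hYinv hZinv)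
    (fun n y hy => ⟨hYinv n y hy.1, hZinv n y hy.2⟩) (hYfin.subset hsub) rfl
  obtain ⟨w, hw, hwy⟩ := h ⟨y, hy, rfl⟩
  obtain ⟨n, rfl⟩ := (Quotient.exact hwy : w ∈ orbit N y)
  simpa using hZinv n⁻¹ _ hw.2

/-- A normal subgroup acting on a tree with trivial edge stabilizers and preserving a subtree
with finitely many orbits has a minimal invariant subtree, and this is invariant under
the whole group. -/
theorem PathConvex.exists_minimal_of_normal {G : Type*} [Group G] [MulAction G V]
    {N : Subgroup G} [N.Normal] [Nontrivial N]
    (hT : ∀ (g : G) v w, T.Adj v w → T.Adj (g • v) (g • w))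
    (hfree : ∀ (n : N) v w, T.Adj v w → s(n • v, n • w) = s(v, w) → n = 1)
    (hTree : T.IsTree) {Y : Set V} (hY : T.PathConvex Y) (hYne : Y.Nonempty)
    (hYinv : ∀ (n : N), ∀ y ∈ Y, n • y ∈ Y)
    (hYfin : ((Quotient.mk (orbitRel N V)) '' Y).Finite) :
    ∃ Y₀ : Set V, Y₀ ⊆ Y ∧ T.PathConvex Y₀ ∧ Y₀.Nonempty ∧ ∀ (g : G), ∀ y ∈ Y₀, g • y ∈ Y₀ := by
  obtain ⟨Y₀, h₀, hne, hinv, hmin⟩ :=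
    hY.exists_minimal (N := N) (fun n => hT n) hfree hTree hYne hYinv hYfin
  refine ⟨Y₀, hmin Y hY hYne hYinv, h₀, hne, fun g => hmin {v | g • v ∈ Y₀} ?_ ?_ ?_⟩
  · intro x y p hp hx hy z hz
    have hinj : Function.Injective (⟨(g • ·), hT g _ _⟩ : T →g T) := MulAction.injective g
    refine h₀ _ (hp.map hinj) hx hy _ ?_
    rw [Walk.support_map]
    exact List.mem_map_of_mem hz
  · obtain ⟨y, hy⟩ := hne
    exact ⟨g⁻¹ • y, by simpa using hy⟩
  · intro n y hy
    have := hinv ⟨g * n * g⁻¹, Subgroup.Normal.conj_mem ‹_› _ n.2 g⟩ _ hy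
    simpa [Subgroup.smul_def, mul_smul] using this

end SimpleGraph

end MinimalSubtree

section BassSerre

variable {G : Type u} [Group G]

/-- Values of nonempty words whose letters lie alternately in `L true` and `L false`, none of them
lying in both; the index is that of the first letter. -/
inductive IsAlternating (L : Bool → Subgroup G) : Bool → G → Prop
  | single {i x} : x ∈ L i → x ∉ L (!i) → IsAlternating L i x
  | mul {i x y} : x ∈ L i → x ∉ L (!i) → IsAlternating L (!i) y → IsAlternating L i (x * y)

variable (L : Bool → Subgroup G)

/-- The Bass-Serre tree of a pair of subgroups `L true` and `L false`. -/
def bassSerreTree : SimpleGraph (Σ i, G ⧸ L i) where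
  Adj x y := ∃ (g : G) (i : Bool), x = ⟨i, (g : G ⧸ L i)⟩ ∧ y = ⟨!i, (g : G ⧸ L (!i))⟩
  symm := ⟨by
    rintro _ _ ⟨g, i, rfl, rfl⟩
    exact ⟨g, !i, rfl, by cases i <;> rfl⟩⟩
  loopless := ⟨by
    rintro _ ⟨g, i, rfl, h⟩
    simpa using congrArg Sigma.fst h⟩

namespace bassSerreTree

variable {L}

theorem mk_eq_mk {i : Bool} {g h : G} :
    (⟨i, (g : G ⧸ L i)⟩ : Σ i, G ⧸ L i) = ⟨i, (h : G ⧸ L i)⟩ ↔ g⁻¹ * h ∈ L i := by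
  rw [Sigma.mk.injEq, heq_eq_eq, QuotientGroup.eq]
  simp

theorem adj_mk (g : G) (i : Bool) :
    (bassSerreTree L).Adj ⟨i, (g : G ⧸ L i)⟩ ⟨!i, (g : G ⧸ L (!i))⟩ :=
  ⟨g, i, rfl, rfl⟩

theorem adj_smul (n : G) (v w : Σ i, G ⧸ L i) (h : (bassSerreTree L).Adj v w) :
    (bassSerreTree L).Adj (n • v) (n • w) := by
  obtain ⟨g, i, rfl, rfl⟩ := h
  exact ⟨n * g, i, rfl, rfl⟩

/-- Every neighbour of `g L i` is of the form `g a L (!i)` with `a ∈ L i`. -/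
theorem exists_of_adj {g : G} {i : Bool} {w : Σ i, G ⧸ L i}
    (h : (bassSerreTree L).Adj ⟨i, (g : G ⧸ L i)⟩ w) :
    ∃ a ∈ L i, w = ⟨!i, (↑(g * a) : G ⧸ L (!i))⟩ := by
  obtain ⟨g', j, hj, rfl⟩ := h
  obtain rfl : i = j := congrArg Sigma.fst hj
  exact ⟨g⁻¹ * g', mk_eq_mk.1 hj, by simp⟩

theorem connected (hL : ⨆ i, L i = ⊤) : (bassSerreTree L).Connected := by
  let P : Subgroup G :=
    { carrier := {x | ∀ g : G, (bassSerreTree L).Reachable ⟨true, g⟩ ⟨true, ↑(g * x)⟩}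
      one_mem' := fun g => by simp
      mul_mem' := fun {x y} hx hy g => (hx g).trans (by simpa [mul_assoc] using hy (g * x))
      inv_mem' := fun {x} hx g => by simpa using (hx (g * x⁻¹)).symm }
  have hP : P = ⊤ := by
    rw [eq_top_iff, ← hL, iSup_le_iff]
    intro i x hx g
    cases i with
    | true => rw [mk_eq_mk.2 (show g⁻¹ * (g * x) ∈ L true by simpa using hx)]
    | false =>
      refine (adj_mk g true).reachable.trans ?_
      rw [Bool.not_true, mk_eq_mk.2 (show g⁻¹ * (g * x) ∈ L false by simpa using hx)]
      exact (adj_mk (g * x) false).reachable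
  have key : ∀ v, (bassSerreTree L).Reachable ⟨true, ((1 : G) : G ⧸ L true)⟩ v := by
    rintro ⟨i, g⟩
    induction g using QuotientGroup.induction_on with
    | H g =>
    have h := (hP ▸ Subgroup.mem_top g : g ∈ P) 1
    rw [one_mul] at h
    cases i with
    | true => exact h
    | false => exact h.trans (adj_mk g true).reachable
  exact { preconnected := fun v w => (key v).symm.trans (key w), nonempty := ⟨⟨true, (1 : G)⟩⟩ }

theorem isPath_end {v w : Σ i, G ⧸ L i} (p : (bassSerreTree L).Walk v w) :
    ∀ (g : G) (i : Bool), v = ⟨i, (g : G ⧸ L i)⟩ → p.IsPath →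
      (¬ p.Nil → p.snd ≠ ⟨!i, (g : G ⧸ L (!i))⟩) →
      p.Nil ∨ ∃ x, IsAlternating L i x ∧ ∃ j, w = ⟨j, (↑(g * x) : G ⧸ L j)⟩ := by
  induction p with
  | nil => simp
  | @cons u v w h p ih =>
    rintro g i rfl hp hsnd
    rw [SimpleGraph.Walk.cons_isPath_iff] at hp
    obtain ⟨a, ha, rfl⟩ := exists_of_adj h
    have ha' : a ∉ L (!i) := fun h' => hsnd (by simp) <| by
      rw [SimpleGraph.Walk.snd_cons]
      exact mk_eq_mk.2 (by simpa using h')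
    have hsnd' : ¬ p.Nil → p.snd ≠ ⟨!(!i), (↑(g * a) : G ⧸ L (!(!i)))⟩ := by
      intro _ hs
      rw [Bool.not_not, mk_eq_mk.2 (show (g * a)⁻¹ * g ∈ L i by simpa using ha)] at hs
      exact hp.2 (hs ▸ p.getVert_mem_support 1)
    refine .inr ?_
    rcases ih _ _ rfl hp.1 hsnd' with hnil | ⟨x, hx, j, rfl⟩
    · obtain rfl := hnil.eq
      exact ⟨a, .single ha ha', _, rfl⟩
    · exact ⟨a * x, .mul ha ha' hx, j, by rw [mul_assoc]⟩

theorem isAcyclic (hL : ∀ i x, IsAlternating L i x → x ∉ L (!i)) :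
    (bassSerreTree L).IsAcyclic := by
  intro v c hc
  cases c with
  | nil => exact absurd hc (by simp)
  | cons h q =>
    rw [SimpleGraph.Walk.cons_isCycle_iff] at hc
    obtain ⟨g, i, rfl, rfl⟩ := h
    have hsnd : ¬ q.Nil → q.snd ≠ ⟨!(!i), (g : G ⧸ L (!(!i)))⟩ := by
      intro hnil hs
      refine hc.2 ?_
      rw [← q.cons_tail_eq hnil, SimpleGraph.Walk.edges_cons, List.mem_cons]
      exact .inl (by rw [hs, Bool.not_not, Sym2.eq_swap])
    rcases isPath_end q g _ rfl hc.1 hsnd with hnil | ⟨x, hx, j, h⟩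
    · simpa using congrArg Sigma.fst hnil.eq
    · obtain rfl : i = j := congrArg Sigma.fst h
      exact hL _ x hx (by simpa using mk_eq_mk.1 h)

theorem eq_one_of_smul_eq {N : Subgroup G} [hN : N.Normal] (hNL : N ⊓ (L true ⊓ L false) = ⊥)
    (n : N) (v w : Σ i, G ⧸ L i) (h : (bassSerreTree L).Adj v w)
    (hn : s(n • v, n • w) = s(v, w)) : n = 1 := by
  obtain ⟨g, i, rfl, rfl⟩ := h
  rcases Sym2.eq_iff.1 hn with ⟨h1, h2⟩ | ⟨h1, -⟩
  · have h1' : g⁻¹ * n⁻¹ * g ∈ L i := by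
      simpa [mul_assoc] using
        mk_eq_mk.1 (show (⟨i, ↑((n : G) * g)⟩ : Σ i, G ⧸ L i) = ⟨i, g⟩ from h1)
    have h2' : g⁻¹ * n⁻¹ * g ∈ L (!i) := by
      simpa [mul_assoc] using
        mk_eq_mk.1 (show (⟨!i, ↑((n : G) * g)⟩ : Σ i, G ⧸ L i) = ⟨!i, g⟩ from h2)
    have h3 : g⁻¹ * (n : G)⁻¹ * g ∈ N ⊓ (L true ⊓ L false) := by
      refine ⟨by simpa using hN.conj_mem _ (inv_mem n.2) g⁻¹, ?_⟩
      cases i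
      · exact ⟨h2', h1'⟩
      · exact ⟨h1', h2'⟩
    rw [hNL, Subgroup.mem_bot] at h3
    ext
    have : (n : G)⁻¹ = g * 1 * g⁻¹ := by rw [← h3]; group
    simpa using this
  · simpa using congrArg Sigma.fst h1

end bassSerreTree

end BassSerre

section PushoutI

variable {H : Type*} [Group H] {K : Bool → Type*} [∀ i, Group (K i)] {φ : ∀ i, H →* K i}

open CoprodI in
theorem Monoid.PushoutI.exists_word_of_isAlternating {i : Bool} {x : PushoutI φ}
    (hx : IsAlternating (fun i => (of (φ := φ) i).range) i x) :
    ∃ w : Word K, Reduced φ w ∧ w.fstIdx = some i ∧ ofCoprodI w.prod = x := by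
  have hred : ∀ {i} {y : K i}, of (φ := φ) i y ∉ (of (φ := φ) (!i)).range → y ∉ (φ i).range := by
    rintro i _ hy ⟨z, rfl⟩
    exact hy ⟨φ _ z, by rw [of_apply_eq_base, of_apply_eq_base]⟩
  have hcons : ∀ {i} {y : K i} (w : Word K), of (φ := φ) i y ∉ (of (φ := φ) (!i)).range →
      w.fstIdx ≠ some i → Reduced φ w → ∃ w' : Word K, Reduced φ w' ∧ w'.fstIdx = some i ∧
        ofCoprodI w'.prod = of (φ := φ) i y * ofCoprodI w.prod := by
    intro i y w hy hi hw
    refine ⟨Word.cons y w hi fun h => hred hy (h ▸ one_mem _), ?_, by simp, by simp⟩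
    rintro g hg
    rcases List.mem_cons.1 hg with rfl | hg
    · exact hred hy
    · exact hw g hg
  induction hx with
  | single h h' =>
    obtain ⟨y, rfl⟩ := h
    obtain ⟨w, hw, hi, hp⟩ := hcons .empty h' (by simp [Word.fstIdx, Word.empty])
      (by simp [Reduced, Word.empty])
    exact ⟨w, hw, hi, by simpa using hp⟩
  | mul h h' _ ih =>
    obtain ⟨y, rfl⟩ := h
    obtain ⟨w, hw, hi, rfl⟩ := ih
    exact hcons w h' (by simp [hi]) hw

theorem Monoid.PushoutI.not_mem_range_of_isAlternating (hφ : ∀ i, Function.Injective (φ i))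
    {i : Bool} {x : PushoutI φ} (hx : IsAlternating (fun i => (of (φ := φ) i).range) i x) :
    x ∉ (of (φ := φ) (!i)).range := by
  have hbase : ∀ {i x}, IsAlternating (fun i => (of (φ := φ) i).range) i x →
      x ∉ (base φ).range := by
    rintro i x hx hxb
    obtain ⟨w, hw, hi, rfl⟩ := exists_word_of_isAlternating hx
    rw [hw.eq_empty_of_mem_range hφ hxb] at hi
    simp [CoprodI.Word.fstIdx, CoprodI.Word.empty] at hi
  intro hxi
  by_cases h : x ∈ (of (φ := φ) i).range
  · refine hbase hx ?_
    rw [← inf_of_range_eq_base_range hφ (show i ≠ !i by simp)]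
    exact ⟨h, hxi⟩
  · refine hbase (.mul (i := !i) (inv_mem hxi) (fun h' => h ?_) (by simpa using hx))
      (inv_mul_cancel x ▸ one_mem _)
    cases i <;> exact inv_mem_iff.1 h'

theorem Monoid.PushoutI.iSup_range_of : ⨆ i, (of (φ := φ) i).range = ⊤ := by
  rw [eq_top_iff]
  intro x _
  induction x using induction_on with
  | of i g => exact Subgroup.mem_iSup_of_mem i ⟨g, rfl⟩
  | base h =>
    rw [← of_apply_eq_base φ true]
    exact Subgroup.mem_iSup_of_mem true ⟨_, rfl⟩
  | mul x y hx hy => exact mul_mem (hx trivial) (hy trivial)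

end PushoutI

section MinRank

variable {G : Type*} [Group G]

theorem Subgroup.exists_closure_eq_of_map {G' : Type*} [Group G'] {f : G →* G'}
    (hf : Function.Injective f) {H : Subgroup G} {S : Finset G'}
    (hS : closure (S : Set G') = H.map f) :
    ∃ S' : Finset G, S'.card ≤ S.card ∧ closure (S' : Set G) = H := by
  classical
  refine ⟨S.preimage f hf.injOn, Finset.card_le_card_of_injOn f (by simp [Set.MapsTo]) hf.injOn, ?_⟩
  apply Subgroup.map_injective hf
  rw [MonoidHom.map_closure, Finset.coe_preimage, Set.image_preimage_eq_of_subset, hS]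
  exact (subset_closure (k := (S : Set G'))).trans (hS ▸ fun x hx => H.map_le_range f hx)

theorem minRank_le_card {H : Subgroup G} {S : Finset G}
    (hS : Subgroup.closure (S : Set G) = H) : minRank H ≤ S.card := by
  obtain ⟨S', hS', hcl⟩ := Subgroup.exists_closure_eq_of_map H.subtype_injective
    (hS.trans (H.range_subtype.symm.trans H.subtype.range_eq_map))
  exact (Nat.sInf_le (s := {n : ℕ | ∃ S : Finset H, S.card = n ∧ Subgroup.closure (S : Set H) = ⊤})
    ⟨S', rfl, hcl⟩).trans hS'

theorem Subgroup.FG.exists_card_eq_minRank {H : Subgroup G} (hH : H.FG) :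
    ∃ S : Finset H, S.card = minRank H ∧ Subgroup.closure (S : Set H) = ⊤ := by
  obtain ⟨S, hS⟩ := ((Group.fg_iff_subgroup_fg H).2 hH).1
  exact Nat.sInf_mem (s := {n : ℕ | ∃ S : Finset H, S.card = n ∧ Subgroup.closure (S : Set H) = ⊤})
    ⟨_, S, rfl, hS⟩

theorem Subgroup.FG.exists_closure_eq {H : Subgroup G} (hH : H.FG) :
    ∃ S : Finset G, S.card ≤ minRank H ∧ Subgroup.closure (S : Set G) = H := by
  classical
  obtain ⟨S, hS, hcl⟩ := hH.exists_card_eq_minRank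
  refine ⟨S.image H.subtype, hS ▸ Finset.card_image_le, ?_⟩
  rw [Finset.coe_image, ← MonoidHom.map_closure, hcl, ← MonoidHom.range_eq_map, H.range_subtype]

end MinRank

section Counting

variable {G : Type u} [Group G]

theorem QuotientGroup.mk_sup_eq_mk_iff {N : Subgroup G} [hN : N.Normal] {L : Subgroup G}
    {g h : G} : (g : G ⧸ N ⊔ L) = h ↔ ∃ n : N, (↑(n * g) : G ⧸ L) = h := by
  rw [QuotientGroup.eq, ← SetLike.mem_coe, Subgroup.normal_mul, Set.mem_mul]
  constructor
  · rintro ⟨n, hn, l, hl, h'⟩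
    refine ⟨⟨g * n * g⁻¹, hN.conj_mem n hn g⟩, QuotientGroup.eq.2 ?_⟩
    rw [show (g * n * g⁻¹ * g)⁻¹ * h = n⁻¹ * (g⁻¹ * h) by group, ← h']
    simpa using hl
  · rintro ⟨n, hn⟩
    refine ⟨g⁻¹ * n * g, by simpa using hN.conj_mem n n.2 g⁻¹, _, QuotientGroup.eq.1 hn, by group⟩

theorem Subgroup.map_conj_stabilizer {N : Subgroup G} [hN : N.Normal] (L : Subgroup G) (g : G) :
    (stabilizer N (g : G ⧸ L)).map ((MulAut.conj g⁻¹).toMonoidHom.comp N.subtype) = N ⊓ L := by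
  ext x
  constructor
  · rintro ⟨n, hn, rfl⟩
    refine ⟨by simpa using hN.conj_mem n n.2 g⁻¹, ?_⟩
    have h : (↑(n * g) : G ⧸ L) = g := hn
    simpa [mul_assoc] using QuotientGroup.eq.1 h.symm
  · rintro ⟨hx, hxL⟩
    refine ⟨⟨g * x * g⁻¹, hN.conj_mem x hx g⟩, ?_, by simp [mul_assoc]⟩
    change (↑(g * x * g⁻¹ * g) : G ⧸ L) = g
    exact (QuotientGroup.eq.2 (by simpa using hxL)).symm

variable {N : Subgroup G} [hN : N.Normal] {L : Bool → Subgroup G}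

theorem OrbitBound.cosets {k : ℤ} (h : OrbitBound N (Σ i, G ⧸ L i) k) :
    OrbitBound N (Σ i, G ⧸ L i) (∑ i, (N ⊔ L i).index * ((minRank ↥(N ⊓ L i) : ℤ) - 1)) ∧
      ∑ i, (N ⊔ L i).index * ((minRank ↥(N ⊓ L i) : ℤ) - 1) ≤ k := by
  classical
  obtain ⟨ι, _, x, S, hx, hinj, hS, hk⟩ := h
  choose g hg using fun j => QuotientGroup.mk_surjective (x j).2
  have hg' : ∀ j, x j = ⟨(x j).1, (g j : G ⧸ L (x j).1)⟩ := fun j => by rw [hg]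
  let π : ι → Σ i, G ⧸ N ⊔ L i := fun j => ⟨(x j).1, g j⟩
  have hmk : ∀ (j : ι) (i : Bool) (h : G), π j = ⟨i, (h : G ⧸ N ⊔ L i)⟩ ↔
      ∃ n : N, n • x j = ⟨i, (h : G ⧸ L i)⟩ := by
    intro j i h
    constructor
    · intro hj
      obtain rfl : (x j).1 = i := congrArg Sigma.fst hj
      simp only [π, Sigma.mk.injEq, heq_eq_eq, true_and] at hj
      obtain ⟨n, hn⟩ := QuotientGroup.mk_sup_eq_mk_iff.1 hj
      refine ⟨n, ?_⟩
      rw [hg' j]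
      exact congrArg (Sigma.mk _) hn
    · rintro ⟨n, hn⟩
      rw [hg' j] at hn
      obtain rfl : (x j).1 = i := congrArg Sigma.fst hn
      refine congrArg (Sigma.mk _) (QuotientGroup.mk_sup_eq_mk_iff.2 ⟨n, ?_⟩)
      exact eq_of_heq (Sigma.mk.inj hn).2
  have hπ : Function.Bijective π := by
    constructor
    · intro j j' hjj
      obtain ⟨n, hn⟩ := (hmk j _ (g j')).1 hjj
      exact hinj j j' n (hn.trans (hg' j').symm)
    · rintro ⟨i, q⟩
      obtain ⟨h, rfl⟩ := QuotientGroup.mk_surjective q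
      obtain ⟨j, hj⟩ := hx ⟨i, h⟩
      exact ⟨j, (hmk j i h).2 hj⟩
  have hfin : ∀ i, Finite (G ⧸ N ⊔ L i) := fun i =>
    have := Finite.of_surjective π hπ.2
    Finite.of_injective (Sigma.mk (β := fun i => G ⧸ N ⊔ L i) i) sigma_mk_injective
  have := fun i => Fintype.ofFinite (G ⧸ N ⊔ L i)
  have hsum : ∑ j, ((minRank ↥(N ⊓ L (x j).1) : ℤ) - 1) =
      ∑ i, (N ⊔ L i).index * ((minRank ↥(N ⊓ L i) : ℤ) - 1) := by
    rw [Function.Bijective.sum_comp hπ fun y => ((minRank ↥(N ⊓ L y.1) : ℤ) - 1),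
      Fintype.sum_sigma]
    refine Finset.sum_congr rfl fun i _ => ?_
    refine (Finset.sum_const ((minRank ↥(N ⊓ L i) : ℤ) - 1)).trans ?_
    rw [nsmul_eq_mul, Finset.card_univ, Subgroup.index, Nat.card_eq_fintype_card]
  have hst : ∀ j, stabilizer N (x j) = stabilizer N (g j : G ⧸ L (x j).1) := by
    intro j
    ext n
    rw [mem_stabilizer_iff, mem_stabilizer_iff, hg' j]
    exact ⟨fun h => eq_of_heq (Sigma.mk.inj h).2, fun h => congrArg (Sigma.mk _) h⟩
  have hcl : ∀ j, Subgroup.closure ((S j).image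
      ((MulAut.conj (g j)⁻¹).toMonoidHom.comp N.subtype) : Set G) = N ⊓ L (x j).1 := fun j => by
    rw [Finset.coe_image, ← MonoidHom.map_closure, hS, hst, Subgroup.map_conj_stabilizer]
  have hex : ∀ j, ∃ S' : Finset N, S'.card ≤ minRank ↥(N ⊓ L (x j).1) ∧
      Subgroup.closure (S' : Set N) = stabilizer N (x j) := fun j => by
    obtain ⟨S', hS', h⟩ := Subgroup.FG.exists_closure_eq ⟨_, hcl j⟩
    rw [← Subgroup.map_conj_stabilizer (L (x j).1) (g j), ← hst] at h
    obtain ⟨S'', h1, h2⟩ := Subgroup.exists_closure_eq_of_map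
      ((MulAut.conj (g j)⁻¹).injective.comp N.subtype_injective) h
    exact ⟨S'', h1.trans hS', h2⟩
  choose S' hS' hS'cl using hex
  refine ⟨⟨ι, ‹_›, x, S', hx, hinj, hS'cl, le_of_le_of_eq (Finset.sum_le_sum fun j _ => ?_) hsum⟩,
    hsum ▸ (Finset.sum_le_sum fun j _ => ?_).trans hk⟩
  · have := hS' j
    omega
  · have := (minRank_le_card (hcl j)).trans Finset.card_image_le
    omega

end Counting

section Edges

variable {G : Type u} [Group G] {N : Subgroup G} [hN : N.Normal] {L : Bool → Subgroup G}

namespace bassSerreTree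

theorem index_le_card {E : Finset (Sym2 (Σ i, G ⧸ L i))}
    (hE : ∀ v w, (bassSerreTree L).Adj v w → EdgeRel N E v w) :
    (N ⊔ (L true ⊓ L false)).FiniteIndex ∧ (N ⊔ (L true ⊓ L false)).index ≤ E.card := by
  have h := fun q : G ⧸ N ⊔ (L true ⊓ L false) => hE _ _ (adj_mk (L := L) q.out true)
  choose e he n hn using h
  have hinj : Function.Injective fun q => (⟨e q, he q⟩ : E) := by
    intro q q' hqq
    replace hqq : e q = e q' := congrArg Subtype.val hqq
    have h1 := (Sym2.mk_inv_smul_eq (hn q)).trans (hqq.trans (Sym2.mk_inv_smul_eq (hn q')).symm)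
    rcases Sym2.eq_iff.1 h1 with ⟨ht, hf⟩ | ⟨ht, -⟩
    · have ht' := mk_eq_mk.1 (show (⟨true, ↑((↑(n q)⁻¹ : G) * q.out)⟩ : Σ i, G ⧸ L i) =
        ⟨true, ↑((↑(n q')⁻¹ : G) * q'.out)⟩ from ht)
      have hf' := mk_eq_mk.1 (show (⟨false, ↑((↑(n q)⁻¹ : G) * q.out)⟩ : Σ i, G ⧸ L i) =
        ⟨false, ↑((↑(n q')⁻¹ : G) * q'.out)⟩ from hf)
      rw [← q.out_eq, ← q'.out_eq]
      refine QuotientGroup.mk_sup_eq_mk_iff.2 ⟨n q' * (n q)⁻¹, QuotientGroup.eq.2 ?_⟩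
      simpa [mul_assoc] using And.intro ht' hf'
    · exact absurd (congrArg Sigma.fst ht) (by simp : ¬ true = false)
  have := Finite.of_injective _ hinj
  refine ⟨Subgroup.finiteIndex_of_finite_quotient, ?_⟩
  rw [Subgroup.index, ← Fintype.card_coe E, ← Nat.card_eq_fintype_card]
  exact Nat.card_le_card_of_injective _ hinj

theorem exists_edgeConnected (hL : ⨆ i, L i = ⊤) [(N ⊔ (L true ⊓ L false)).FiniteIndex] :
    ∃ E : Finset (Sym2 (Σ i, G ⧸ L i)), E.card ≤ (N ⊔ (L true ⊓ L false)).index ∧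
      EdgeConnected N E := by
  classical
  have := Fintype.ofFinite (G ⧸ N ⊔ (L true ⊓ L false))
  let e : G ⧸ N ⊔ (L true ⊓ L false) → Sym2 (Σ i, G ⧸ L i) := fun q =>
    s(⟨true, q.out⟩, ⟨false, q.out⟩)
  refine ⟨Finset.univ.image e, ?_, fun v w => ?_⟩
  · rw [Subgroup.index, Nat.card_eq_fintype_card]
    exact Finset.card_image_le
  have key : ∀ g : G, EdgeRel N (Finset.univ.image e) ⟨true, g⟩ ⟨false, g⟩ := by
    intro g
    obtain ⟨n, hn⟩ := QuotientGroup.mk_sup_eq_mk_iff.1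
      (Quotient.out_eq (g : G ⧸ N ⊔ (L true ⊓ L false)))
    have h := QuotientGroup.eq.1 hn
    refine ⟨e g, Finset.mem_image_of_mem _ (Finset.mem_univ _), n, ?_⟩
    exact (congrArg₂ (s(·, ·)) (mk_eq_mk.2 h.1) (mk_eq_mk.2 h.2)).symm
  obtain ⟨p⟩ := connected hL v w
  induction p with
  | nil => exact .refl _
  | cons h _ ih =>
    refine .trans _ _ _ (.rel _ _ ?_) ih
    obtain ⟨g, i, rfl, rfl⟩ := h
    cases i
    · exact (key g).symm
    · exact key g

theorem eq_univ_of_pathConvex (hL : ⨆ i, L i = ⊤) (hne : ∀ i, L i ≠ ⊤)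
    {Y : Set (Σ i, G ⧸ L i)} (hY : (bassSerreTree L).PathConvex Y) (hYne : Y.Nonempty)
    (hinv : ∀ (g : G), ∀ y ∈ Y, g • y ∈ Y) : Y = Set.univ := by
  obtain ⟨⟨i, q⟩, hq⟩ := hYne
  obtain ⟨g, rfl⟩ := QuotientGroup.mk_surjective q
  have hi : ∀ h : G, (⟨i, (h : G ⧸ L i)⟩ : Σ i, G ⧸ L i) ∈ Y := fun h => by
    have h' : (⟨i, (↑(h * g⁻¹ * g) : G ⧸ L i)⟩ : Σ i, G ⧸ L i) ∈ Y := hinv (h * g⁻¹) _ hq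
    simpa using h'
  obtain ⟨b, hb, hbi⟩ : ∃ b ∈ L (!i), b ∉ L i := by
    by_contra! h
    refine hne i (top_le_iff.1 (hL ▸ iSup_le fun j => ?_))
    rcases Bool.eq_or_eq_not j i with rfl | rfl
    exacts [le_rfl, h]
  have h1 : ∀ h : G, (⟨!i, (h : G ⧸ L (!i))⟩ : Σ i, G ⧸ L i) ∈ Y := by
    intro h
    have hadj : (bassSerreTree L).Adj ⟨!i, (h : G ⧸ L (!i))⟩ ⟨i, (↑(h * b) : G ⧸ L i)⟩ := by
      rw [mk_eq_mk.2 (show h⁻¹ * (h * b) ∈ L (!i) by simpa using hb)]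
      exact (adj_mk (h * b) i).symm
    refine hY (.cons (adj_mk h i) (.cons hadj .nil)) ?_ (hi h) (hi _) _ (by simp)
    simp [QuotientGroup.eq, hbi]
  ext ⟨j, q⟩
  obtain ⟨h, rfl⟩ := QuotientGroup.mk_surjective q
  rcases Bool.eq_or_eq_not j i with rfl | rfl
  · simpa using hi h
  · simpa using h1 h

end bassSerreTree

theorem OrbitBound.of_bijective {N : Type u} [Group N] {X : Type u} {V : Type v}
    [MulAction N X] [MulAction N V] {k : ℤ} (h : OrbitBound N X k) (f : X →[N] V) (hf : Function.Bijective f) :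
    OrbitBound N V k := by
  obtain ⟨ι, _, x, S, hx, hinj, hS, hk⟩ := h
  refine ⟨ι, ‹_›, f ∘ x, S, fun v => ?_, fun i j n hn => ?_, fun i => ?_, hk⟩
  · obtain ⟨y, rfl⟩ := hf.2 v
    obtain ⟨i, n, rfl⟩ := hx y
    exact ⟨i, n, (map_smul f n _).symm⟩
  · exact hinj i j n (hf.1 ((map_smul f n _).trans hn))
  · ext n
    rw [hS, mem_stabilizer_iff, mem_stabilizer_iff, Function.comp_apply, ← map_smul, hf.1.eq_iff]

theorem OrbitBound.finite_image {N : Type u} [Group N] {X : Type u} {V : Type v}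
    [MulAction N X] [MulAction N V] {k : ℤ} (h : OrbitBound N X k) (f : X →[N] V) :
    ((Quotient.mk (orbitRel N V)) '' Set.range f).Finite := by
  obtain ⟨ι, _, x, -, hx, -⟩ := h
  refine (Set.finite_range fun i => Quotient.mk (orbitRel N V) (f (x i))).subset ?_
  rintro _ ⟨_, ⟨y, rfl⟩, rfl⟩
  obtain ⟨i, n, rfl⟩ := hx y
  refine ⟨i, Quotient.sound ?_⟩
  exact ⟨n⁻¹, by simp⟩

/-- The rank formula for a normal subgroup with trivial edge stabilizers in an amalgamated product
of two proper subgroups. -/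
theorem minRank_eq_sum (hL : ⨆ i, L i = ⊤) (halt : ∀ i x, IsAlternating L i x → x ∉ L (!i))
    (hne : ∀ i, L i ≠ ⊤) [Nontrivial N] (hfg : N.FG) (hNL : N ⊓ (L true ⊓ L false) = ⊥) :
    (minRank N : ℤ) - 1 = ∑ i, (N ⊔ L i).index * ((minRank ↥(N ⊓ L i) : ℤ) - 1) +
      (N ⊔ (L true ⊓ L false)).index := by
  classical
  obtain ⟨S, hS, hcl⟩ := hfg.exists_card_eq_minRank
  have hTree : (bassSerreTree L).IsTree :=
    ⟨bassSerreTree.connected hL, bassSerreTree.isAcyclic halt⟩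
  have hadj := bassSerreTree.adj_smul (L := L)
  have hfree := bassSerreTree.eq_one_of_smul_eq hNL
  obtain ⟨Y, hYne, ⟨k, hk, hkc⟩, hinj, hconv, hE⟩ :=
    MarkedGraph.exists_subtree (fun n : N => hadj n) hfree hTree S hcl
  obtain ⟨Y₀, hsub, hconv₀, hne₀, hinv₀⟩ := hconv.exists_minimal_of_normal hadj hfree hTree
    (Set.range_nonempty Y.f) (by rintro n _ ⟨x, rfl⟩; exact ⟨n • x, map_smul Y.f n x⟩)
    (hk.finite_image Y.f)
  rw [bassSerreTree.eq_univ_of_pathConvex hL hne hconv₀ hne₀ hinv₀, Set.univ_subset_iff,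
    Set.range_eq_univ] at hsub
  obtain ⟨hk', hle⟩ := (hk.of_bijective Y.f ⟨hinj, hsub⟩).cosets
  obtain ⟨hfi, hidx⟩ := bassSerreTree.index_le_card (N := N) (L := L)
    (E := Y.E.image (Sym2.map Y.f)) (fun v w hvw => by
      obtain ⟨x, rfl⟩ := hsub v
      obtain ⟨y, rfl⟩ := hsub w
      exact EdgeRel.map Y.f (fun e he => Finset.mem_image_of_mem _ he) (hE x y hvw))
  obtain ⟨E, hEcard, hEconn⟩ := bassSerreTree.exists_edgeConnected (N := N) hL
  have : Nonempty (Σ i, G ⧸ L i) := ⟨⟨true, (1 : G)⟩⟩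
  obtain ⟨S', hcl', hS'⟩ := hk'.exists_generators hEconn
  have h1 : (minRank N : ℤ) ≤ S'.card := by
    exact_mod_cast Nat.sInf_le (s := {n : ℕ | ∃ S : Finset N, S.card = n ∧
      Subgroup.closure (S : Set N) = ⊤}) ⟨S', rfl, hcl'⟩
  have h2 : (Y.E.image (Sym2.map Y.f)).card ≤ Y.E.card := Finset.card_image_le
  zify at hidx hEcard h2 hS
  linarith

end Edges

/-- Let `G = A ∗_C B` be an amalgamated free product and let `N` be a
nontrivial finitely generated normal subgroup of `G` with `N ∩ C = {1}`.  With
`a = [G : NA]`, `b = [G : NB]`, `c = [G : NC]`, one has, as an equation of integers,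
`rank N = a·rank(N ⊓ A) + b·rank(N ⊓ B) + 1 + c − a − b`. -/
theorem stmt_15 {H : Type*} [Group H] {K : Bool → Type*} [∀ i, Group (K i)]
    (φ : ∀ i, H →* K i) (hφ : ∀ i, Function.Injective (φ i))
    (A B C N : Subgroup (PushoutI φ))
    (hA : A = (PushoutI.of (φ := φ) true).range)
    (hB : B = (PushoutI.of (φ := φ) false).range)
    (hC : C = (PushoutI.base φ).range)
    (hNnorm : N.Normal) (hNne : N ≠ ⊥) (hNfg : N.FG) (hNC : N ⊓ C = ⊥)
    (a b c : ℕ) (ha : a = (N ⊔ A).index) (hb : b = (N ⊔ B).index)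
    (hc : c = (N ⊔ C).index) :
    (minRank N : ℤ) =
      a * minRank ↥(N ⊓ A) + b * minRank ↥(N ⊓ B) + 1 + c - a - b := by
  have hABC : A ⊓ B = C := by
    rw [hA, hB, hC, PushoutI.inf_of_range_eq_base_range hφ (by simp)]
  have hbot : minRank ↥(⊥ : Subgroup (PushoutI φ)) = 0 :=
    Nat.le_zero.1 (minRank_le_card (S := ∅) (by simp))
  subst ha hb hc
  by_cases hAtop : A = ⊤
  · obtain rfl : B = C := by rw [← hABC, hAtop, top_inf_eq]
    rw [hNC, hbot, hAtop, inf_top_eq, sup_top_eq, Subgroup.index_top]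
    push_cast
    ring
  by_cases hBtop : B = ⊤
  · obtain rfl : A = C := by rw [← hABC, hBtop, inf_top_eq]
    rw [hNC, hbot, hBtop, inf_top_eq, sup_top_eq, Subgroup.index_top]
    push_cast
    ring
  have : Nontrivial N := (Subgroup.nontrivial_iff_ne_bot N).2 hNne
  have h := minRank_eq_sum (N := N) (L := fun i => (PushoutI.of (φ := φ) i).range)
    PushoutI.iSup_range_of (fun _ _ => PushoutI.not_mem_range_of_isAlternating hφ)
    (Bool.rec (hB ▸ hBtop) (hA ▸ hAtop)) hNfg (by rw [← hA, ← hB, hABC, hNC])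
  subst hA hB hC
  rw [Fintype.sum_bool, hABC] at h
  linarith
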